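/- Let G = (V, E) be a finite simple graph that admits a proper 4-coloring, i.e., a map c : V → {1, 2, 3, 4} with c(u) ≠ c(v) whenever (u, v) ∈ E. Then there exist nine Pauli strings B_1, …, B_9 : V → {X, Y, Z} such that for every edge (u, v) ∈ E the nine pairs (B_k(u), B_k(v)), k = 1, …, 9, exactly cover {X, Y, Z}² (i.e., the map k ↦ (B_k(u), B_k(v)) is a bijection from {1, …, 9} onto {X, Y, Z} × {X, Y, Z}). Explicitly, B_k(v) may be taken to be the entry in row k and column c(v) of the 9 × 4 table with rows XXXX, XYYY, XZZZ, YXZY, YYXZ, YZYX, ZXYZ, ZYZX, ZZXY. -/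

import Mathlib

/-- Table I of the paper: nine Pauli strings on four columns, with the Pauli labels
`X, Y, Z` modeled as `0, 1, 2 : Fin 3`.  The rows are
`XXXX, XYYY, XZZZ, YXZY, YYXZ, YZYX, ZXYZ, ZYZX, ZZXY`. -/
def pauliTable : Fin 9 → Fin 4 → Fin 3 :=
  ![![0, 0, 0, 0],
    ![0, 1, 1, 1],
    ![0, 2, 2, 2],
    ![1, 0, 2, 1],
    ![1, 1, 0, 2],
    ![1, 2, 1, 0],
    ![2, 0, 1, 2],
    ![2, 1, 2, 0],
    ![2, 2, 0, 1]]

/-- Any two distinct columns of the table exactly cover all nine pairs. -/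
theorem pauliTable_bijective (a b : Fin 4) (hab : a ≠ b) :
    Function.Bijective (fun k : Fin 9 => (pauliTable k a, pauliTable k b)) := by
  rw [Fintype.bijective_iff_injective_and_card]
  refine ⟨?_, by simp⟩
  have key : ∀ a b : Fin 4, a ≠ b → ∀ i j : Fin 9,
      pauliTable i a = pauliTable j a → pauliTable i b = pauliTable j b → i = j := by
    set_option maxRecDepth 100000 in decide
  intro i j h
  exact key a b hab i j (congrArg Prod.fst h) (congrArg Prod.snd h)

/-- **Extension argument from the paper's proof of Theorem 2.**
If a finite simple graph `G` admits a proper 4-coloring `c : V → Fin 4`, then there exist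
nine Pauli strings `B k : V → {X, Y, Z}` such that for every edge `(u, v)` the map
`k ↦ (B k u, B k v)` is a bijection from `Fin 9` onto `{X, Y, Z} × {X, Y, Z}`; explicitly,
one may take `B k v = pauliTable k (c v)` (row `k`, column `c v` of Table I). -/
theorem nine_pauli_strings_of_four_coloring
    {V : Type*} [Fintype V] (G : SimpleGraph V) (c : V → Fin 4)
    (hc : ∀ u v : V, G.Adj u v → c u ≠ c v) :
    ∃ B : Fin 9 → V → Fin 3,
      (∀ u v : V, G.Adj u v →
        Function.Bijective (fun k : Fin 9 => (B k u, B k v))) ∧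
      B = fun k v => pauliTable k (c v) := by
  refine ⟨fun k v => pauliTable k (c v), fun u v huv => ?_, rfl⟩
  exact pauliTable_bijective (c u) (c v) (hc u v huv)
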